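/- For any N ≥ 1 and any N distinct real numbers E₁,…,E_N, there exists a function q ∈ C^∞(ℝ) with limsup_{x→∞} x^{1-α/2}·|q(x)| ≤ (2-α)·e^{2√(ln N)}·N such that, for each j = 1,…,N, there exists an L²(ℝ) eigenfunction for energy E_j of -u'' + ṽ·u + q·u. -/

import Mathlib

open Filter MeasureTheory Set Real

/-- An `L²(ℝ)` eigenfunction for energy `E` of the operator `-D² + ṽ + q`. -/
def HasL2Eigenfunction (vt q : ℝ → ℝ) (E : ℝ) : Prop :=
  ∃ u : ℝ → ℝ, ContDiff ℝ 2 u ∧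
    (∀ x : ℝ, -(deriv (deriv u) x) + vt x * u x + q x * u x = E * u x) ∧
    (∃ x : ℝ, u x ≠ 0) ∧
    MeasureTheory.Integrable (fun x => (u x) ^ 2)

theorem stk_global_ode {V : Type*} [NormedAddCommGroup V] [NormedSpace ℝ V] [CompleteSpace V]
    (f : ℝ → V → V) (t0 : ℝ) (x0 : V) (hc : ∀ x, Continuous (fun t => f t x))
    (hb : ∀ T : ℝ, ∃ L K : NNReal, ∀ t, |t - t0| ≤ T → (∀ x, ‖f t x‖ ≤ L) ∧ LipschitzWith K (f t)) :
    ∃ y : ℝ → V, y t0 = x0 ∧ ∀ t, HasDerivAt y (f t (y t)) t := by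
  have key : ∀ n : ℕ, ∃ y : ℝ → V, y t0 = x0 ∧
      ∀ t ∈ Ioo (t0 - (n+1)) (t0 + (n+1)), HasDerivAt y (f t (y t)) t := by
    intro n
    obtain ⟨L, K, h⟩ := hb (n+1)
    have h' : ∀ t ∈ Icc (t0 - ((n:ℝ)+1)) (t0 + (n+1)), |t - t0| ≤ n+1 := by
      intro t ht; rw [abs_le]; constructor <;> linarith [ht.1, ht.2]
    have hn : (0:ℝ) ≤ n := Nat.cast_nonneg n
    have hP : IsPicardLindelof f (tmin := t0 - ((n:ℝ)+1)) (tmax := t0 + (n+1))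
        ⟨t0, by constructor <;> linarith⟩ x0 (L * (n+1)) 0 L K := by
      constructor
      · intro t ht; exact (h t (h' t ht)).2.lipschitzOnWith
      · intro x _; exact (hc x).continuousOn
      · intro t ht x _; exact (h t (h' t ht)).1 x
      · simp
    obtain ⟨y, hy0, hy⟩ := hP.exists_eq_forall_mem_Icc_hasDerivWithinAt₀
    refine ⟨y, hy0, fun t ht => ?_⟩
    exact (hy t (Ioo_subset_Icc_self ht)).hasDerivAt (Icc_mem_nhds ht.1 ht.2)
  choose y hy0 hy using key
  have hagree : ∀ m n : ℕ, m ≤ n → EqOn (y m) (y n) (Ioo (t0 - ((m:ℝ)+1)) (t0 + (m+1))) := by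
    intro m n hmn
    obtain ⟨L, K, h⟩ := hb (m+1)
    have hm : (0:ℝ) ≤ m := Nat.cast_nonneg m
    have hmn' : (m:ℝ) ≤ n := by exact_mod_cast hmn
    refine ODE_solution_unique_of_mem_Ioo (v := f) (K := K) (s := fun _ => univ) (t₀ := t0) ?_ ?_ ?_ ?_ ?_
    · intro t ht
      refine (h t ?_).2.lipschitzOnWith
      rw [abs_le]; constructor <;> linarith [ht.1, ht.2]
    · constructor <;> linarith
    · intro t ht; exact ⟨hy m t ht, mem_univ _⟩
    · intro t ht; exact ⟨hy n t ⟨by linarith [ht.1], by linarith [ht.2]⟩, mem_univ _⟩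
    · rw [hy0, hy0]
  refine ⟨fun t => y ⌈|t - t0|⌉₊ t, by simp [hy0], fun t => ?_⟩
  set n := ⌈|t - t0|⌉₊ with hn
  have hle : |t - t0| ≤ n := Nat.le_ceil _
  have htn : t ∈ Ioo (t0 - ((n:ℝ)+1)) (t0 + (n+1)) := by
    rw [abs_le] at hle; constructor <;> linarith
  have h1 := hy n t htn
  refine h1.congr_of_eventuallyEq ?_
  filter_upwards [Ioo_mem_nhds htn.1 htn.2] with s hs
  rcases le_total ⌈|s - t0|⌉₊ n with hh | hh
  · refine hagree _ _ hh ?_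
    have := Nat.le_ceil |s - t0|
    rw [abs_le] at this
    constructor <;> linarith
  · exact (hagree _ _ hh hs).symm

/-- Pointwise modified Prüfer transform. -/
theorem stk_prufer (p p' θ L : ℝ → ℝ) (x q : ℝ) (hp : 0 < p x)
    (hp' : HasDerivAt p (p' x) x)
    (hθ : HasDerivAt θ (p x + p' x / p x * (sin (θ x) * cos (θ x)) - q / p x * sin (θ x) ^ 2) x)
    (hL : HasDerivAt L (-(p' x / (2 * p x)) * cos (2 * θ x) + q / (2 * p x) * sin (2 * θ x)) x) :
    HasDerivAt (fun t => exp (L t) * sin (θ t) / sqrt (p t)) (sqrt (p x) * (exp (L x) * cos (θ x))) x ∧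
    HasDerivAt (fun t => sqrt (p t) * (exp (L t) * cos (θ t)))
      ((q - p x ^ 2) * (exp (L x) * sin (θ x) / sqrt (p x))) x := by
  have hs : 0 < sqrt (p x) := sqrt_pos.2 hp
  have hsq : HasDerivAt (fun t => sqrt (p t)) (p' x / (2 * sqrt (p x))) x := hp'.sqrt hp.ne'
  have hsp : p x = sqrt (p x) ^ 2 := (sq_sqrt hp.le).symm
  have h1 := (hL.exp.mul hθ.sin).div hsq hs.ne'
  have h2 := hsq.mul (hL.exp.mul hθ.cos)
  rw [cos_two_mul, sin_two_mul] at h1 h2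
  set s := sqrt (p x)
  set a := sin (θ x)
  set c := cos (θ x)
  set e := exp (L x)
  have hac : c ^ 2 = 1 - a ^ 2 := by
    have := sin_sq_add_cos_sq (θ x); simp only [a, c]; linarith
  simp only [Pi.mul_apply] at h1 h2
  constructor
  · refine h1.congr_deriv ?_
    change (((e * (-(p' x / (2 * p x)) * (2 * c ^ 2 - 1) + q / (2 * p x) * (2 * a * c)) * a +
            e * (c * (p x + p' x / p x * (a * c) - q / p x * a ^ 2))) * s - e * a * (p' x / (2 * s))) / s ^ 2) = _
    rw [hsp]
    field_simp
    ring
  · refine h2.congr_deriv ?_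
    change p' x / (2 * s) * (e * c) + s *
        (e * (-(p' x / (2 * p x)) * (2 * c ^ 2 - 1) + q / (2 * p x) * (2 * a * c)) * c +
          e * (-a * (p x + p' x / p x * (a * c) - q / p x * a ^ 2))) = (q - p x ^ 2) * (e * a / s)
    rw [hsp]
    field_simp
    linear_combination (2 * e * (q * a - p' x * c)) * hac

theorem stk_lin (W : ℝ → ℝ) (hW : Continuous W) (t0 θ0 : ℝ) :
    ∃ u v : ℝ → ℝ, u t0 = sin θ0 ∧ v t0 = cos θ0 ∧ (∀ x, HasDerivAt u (v x) x) ∧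
      ∀ x, HasDerivAt v (W x * u x) x := by
  obtain ⟨θ, h0, hθ⟩ := stk_global_ode (fun t (y : ℝ) => 1 - (W t + 1) * sin y ^ 2) t0 θ0
    (fun x => by fun_prop) (by
      intro T
      obtain ⟨M, hM⟩ := (isCompact_Icc (a := t0 - T) (b := t0 + T)).exists_bound_of_continuousOn
        (f := fun t => W t + 1) (by fun_prop)
      have hM' : ∀ t, |t - t0| ≤ T → |W t + 1| ≤ |M| := by
        intro t ht
        rw [abs_le] at ht
        exact (hM t ⟨by linarith, by linarith⟩).trans (le_abs_self M)
      refine ⟨⟨1 + |M|, by positivity⟩, ⟨2 * |M|, by positivity⟩, fun t ht => ⟨fun x => ?_, ?_⟩⟩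
      · have h1 := hM' t ht
        have h2 := sin_sq_le_one x
        have h3 := sq_nonneg (sin x)
        change |1 - (W t + 1) * sin x ^ 2| ≤ 1 + |M|
        calc |1 - (W t + 1) * sin x ^ 2| ≤ |(1:ℝ)| + |(W t + 1) * sin x ^ 2| := abs_sub _ _
          _ ≤ 1 + |M| := by
            rw [abs_one, abs_mul, abs_of_nonneg h3]
            nlinarith [abs_nonneg (W t + 1)]
      · refine LipschitzWith.of_dist_le_mul fun x y => ?_
        rw [Real.dist_eq, Real.dist_eq]
        change |1 - (W t + 1) * sin x ^ 2 - (1 - (W t + 1) * sin y ^ 2)| ≤ 2 * |M| * |x - y|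
        have e : 1 - (W t + 1) * sin x ^ 2 - (1 - (W t + 1) * sin y ^ 2)
          = -(W t + 1) * ((sin x + sin y) * (sin x - sin y)) := by ring
        rw [e, abs_mul, abs_mul, abs_neg]
        have h1 := hM' t ht
        have h2 : |sin x + sin y| ≤ 2 := by
          have := abs_add_le (sin x) (sin y); linarith [abs_sin_le_one x, abs_sin_le_one y]
        have h3 : |sin x - sin y| ≤ |x - y| := by
          simpa [Real.dist_eq] using (lipschitzWith_sin.dist_le_mul x y)
        calc |W t + 1| * (|sin x + sin y| * |sin x - sin y|) ≤ |M| * (2 * |x - y|) := by gcongr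
          _ = _ := by ring)
  have hθc : Continuous θ := continuous_iff_continuousAt.2 fun x => (hθ x).continuousAt
  have hint : Continuous (fun x => (W x + 1) / 2 * sin (2 * θ x)) := by fun_prop
  set L : ℝ → ℝ := fun x => ∫ t in t0..x, (W t + 1) / 2 * sin (2 * θ t) with hLdef
  have hL : ∀ x, HasDerivAt L ((W x + 1) / 2 * sin (2 * θ x)) x := fun x =>
    intervalIntegral.integral_hasDerivAt_right (hint.intervalIntegrable _ _)
      (hint.stronglyMeasurableAtFilter _ _) hint.continuousAt
  have key := fun x => stk_prufer (fun _ => 1) (fun _ => 0) θ L x (W x + 1) one_pos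
    (hasDerivAt_const _ _) (by simpa using hθ x) (by simpa using hL x)
  refine ⟨fun t => exp (L t) * sin (θ t) / sqrt 1, fun t => sqrt 1 * (exp (L t) * cos (θ t)), ?_, ?_,
    fun x => (key x).1, fun x => ?_⟩
  · simp [hLdef, h0]
  · simp [hLdef, h0]
  · refine (key x).2.congr_deriv ?_
    ring

theorem stk_left (W : ℝ → ℝ) (hW : Continuous W) (hWt : Tendsto W atBot atTop) :
    ∃ u v : ℝ → ℝ, (∀ x, HasDerivAt u (v x) x) ∧ (∀ x, HasDerivAt v (W x * u x) x) ∧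
      (∀ x, u x ≠ 0 ∨ v x ≠ 0) ∧ ∀ b, IntegrableOn (fun x => u x ^ 2) (Iic b) := by
  obtain ⟨t0, ht0⟩ := eventually_atBot.1 (hWt.eventually_ge_atTop 1)
  obtain ⟨φ, φ', hφ0, hφ'0, hφ, hφ'⟩ := stk_lin W hW t0 (3 * π / 4)
  obtain ⟨χ, χ', hχ0, hχ'0, hχ, hχ'⟩ := stk_lin W hW t0 (π / 4)
  have e1 : sin (3 * π / 4) = √2 / 2 := by
    rw [show 3 * π / 4 = π - π / 4 by ring, sin_pi_sub, sin_pi_div_four]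
  have e2 : cos (3 * π / 4) = - (√2 / 2) := by
    rw [show 3 * π / 4 = π - π / 4 by ring, cos_pi_sub, cos_pi_div_four]
  rw [e1] at hφ0
  rw [e2] at hφ'0
  rw [sin_pi_div_four] at hχ0
  rw [cos_pi_div_four] at hχ'0
  have s2 : √2 * √2 = (2:ℝ) := mul_self_sqrt (by norm_num)
  -- Wronskian
  have hwr : ∀ x, φ x * χ' x - φ' x * χ x = 1 := by
    have hd : ∀ x, HasDerivAt (fun x => φ x * χ' x - φ' x * χ x) 0 x := by
      intro x
      refine (((hφ x).mul (hχ' x)).sub ((hφ' x).mul (hχ x))).congr_deriv ?_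
      ring
    intro x
    have := is_const_of_deriv_eq_zero (fun x => (hd x).differentiableAt) (fun x => (hd x).deriv) x t0
    rw [this, hφ0, hφ'0, hχ0, hχ'0]
    linarith
  set G : ℝ → ℝ := fun x => φ x ^ 2 with hG
  have hGd : ∀ x, HasDerivAt G (2 * (φ x * φ' x)) x := fun x =>
    ((hφ x).pow 2).congr_deriv (by simp; ring)
  have hk : ∀ x ≤ t0, φ x * φ' x + G x ≤ 0 := by
    have hd : ∀ x, HasDerivAt (fun x => φ x * φ' x + G x)
        (φ' x ^ 2 + W x * φ x ^ 2 + 2 * (φ x * φ' x)) x := by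
      intro x
      exact (((hφ x).mul (hφ' x)).add (hGd x)).congr_deriv (by ring)
    have hm : MonotoneOn (fun x => φ x * φ' x + G x) (Iic t0) := by
      refine monotoneOn_of_hasDerivWithinAt_nonneg (convex_Iic t0)
        (fun x _ => (hd x).continuousAt.continuousWithinAt)
        (fun x _ => (hd x).hasDerivWithinAt) ?_
      intro x hx
      rw [interior_Iic] at hx
      have := ht0 x (le_of_lt hx)
      nlinarith [sq_nonneg (φ x + φ' x), sq_nonneg (φ x)]
    intro x hx
    have := hm (mem_Iic.2 hx) (mem_Iic.2 le_rfl) hx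
    simp only [hφ0, hφ'0, hG] at this ⊢
    nlinarith
  -- growth
  have hGe : ∀ x ≤ t0, 1 / 2 * exp (2 * t0) ≤ G x * exp (2 * x) := by
    have hd : ∀ x, HasDerivAt (fun x => G x * exp (2 * x))
        (2 * (φ x * φ' x + G x) * exp (2 * x)) x := by
      intro x
      refine ((hGd x).mul (((hasDerivAt_id x).const_mul 2).exp)).congr_deriv ?_
      simp; ring
    have hm : AntitoneOn (fun x => G x * exp (2 * x)) (Iic t0) := by
      refine antitoneOn_of_hasDerivWithinAt_nonpos (convex_Iic t0)
        (fun x _ => (hd x).continuousAt.continuousWithinAt)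
        (fun x _ => (hd x).hasDerivWithinAt) ?_
      intro x hx
      rw [interior_Iic] at hx
      have := hk x (le_of_lt hx)
      nlinarith [exp_pos (2 * x)]
    intro x hx
    have := hm (mem_Iic.2 hx) (mem_Iic.2 le_rfl) hx
    simp only [hφ0, hG] at this ⊢
    have e : (√2 / 2) ^ 2 = (1/2:ℝ) := by nlinarith
    rwa [e] at this
  have hGpos : ∀ x ≤ t0, 0 < G x := by
    intro x hx
    have h := hGe x hx
    by_contra hc
    push Not at hc
    nlinarith [exp_pos (2 * x), exp_pos (2 * t0)]
  have hφne : ∀ x ≤ t0, φ x ≠ 0 := by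
    intro x hx h
    have := hGpos x hx
    simp [hG, h] at this
  set r : ℝ → ℝ := fun x => χ x / φ x with hr
  have hrd : ∀ x ≤ t0, HasDerivAt r (1 / G x) x := by
    intro x hx
    refine ((hχ x).div (hφ x) (hφne x hx)).congr_deriv ?_
    rw [hG]
    congr 1
    linarith [hwr x]
  have hrm : MonotoneOn r (Iic t0) := by
    refine monotoneOn_of_hasDerivWithinAt_nonneg (convex_Iic t0)
      (fun x hx => (hrd x hx).continuousAt.continuousWithinAt)
      (f' := fun x => 1 / G x)
      (fun x hx => (hrd x (interior_subset (s := Iic t0) hx)).hasDerivWithinAt) ?_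
    intro x hx
    have := hGpos x (interior_subset (s := Iic t0) hx)
    positivity
  have hsm : MonotoneOn (fun x => 1 / 2 * (G x)⁻¹ - r x) (Iic t0) := by
    have hd : ∀ x ≤ t0, HasDerivAt (fun x => 1 / 2 * (G x)⁻¹ - r x)
        (- (φ x * φ' x + G x) / G x ^ 2) x := by
      intro x hx
      have := hGpos x hx
      refine ((((hGd x).inv this.ne').const_mul (1/2)).sub (hrd x hx)).congr_deriv ?_
      field_simp
      ring
    refine monotoneOn_of_hasDerivWithinAt_nonneg (convex_Iic t0)
      (fun x hx => (hd x hx).continuousAt.continuousWithinAt)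
      (fun x hx => (hd x (interior_subset (s := Iic t0) hx)).hasDerivWithinAt) ?_
    intro x hx
    have := hGpos x (interior_subset (s := Iic t0) hx)
    have := hk x (interior_subset (s := Iic t0) hx)
    apply div_nonneg <;> [linarith; positivity]
  have hlow : ∀ x ≤ t0, ∀ y ≤ t0, r y - 1 / 2 * (G y)⁻¹ ≤ r x := by
    intro x hx y hy
    rcases le_total x y with h | h
    · have h1 := hsm (mem_Iic.2 hx) (mem_Iic.2 hy) h
      have h2 : 0 < (G x)⁻¹ := inv_pos.2 (hGpos x hx)
      simp only at h1
      linarith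
    · have h1 := hrm (mem_Iic.2 hy) (mem_Iic.2 hx) h
      have h2 : 0 < (G y)⁻¹ := inv_pos.2 (hGpos y hy)
      linarith
  set l := sInf (r '' Iic t0) with hl
  have hl1 : ∀ y ≤ t0, l ≤ r y := fun y hy =>
    csInf_le ⟨r t0 - 1 / 2 * (G t0)⁻¹, by rintro _ ⟨x, hx, rfl⟩; exact hlow x hx t0 le_rfl⟩
      ⟨y, hy, rfl⟩
  have hl2 : ∀ y ≤ t0, r y - 1 / 2 * (G y)⁻¹ ≤ l := fun y hy =>
    le_csInf ⟨r t0, t0, mem_Iic.2 le_rfl, rfl⟩ (by rintro _ ⟨x, hx, rfl⟩; exact hlow x hx y hy)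
  have hu : ∀ x, HasDerivAt (fun x => χ x - l * φ x) (χ' x - l * φ' x) x := fun x =>
    (hχ x).sub ((hφ x).const_mul l)
  refine ⟨fun x => χ x - l * φ x, fun x => χ' x - l * φ' x, hu, fun x => ?_, fun x => ?_, fun b => ?_⟩
  · exact ((hχ' x).sub ((hφ' x).const_mul l)).congr_deriv (by ring)
  · by_contra hcon
    push Not at hcon
    have := hwr x
    have h1 : χ x = l * φ x := by linarith [hcon.1]
    have h2 : χ' x = l * φ' x := by linarith [hcon.2]
    rw [h1, h2] at this
    have : (0:ℝ) = 1 := by linarith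
    norm_num at this
  · have hcont : Continuous (fun x => (χ x - l * φ x) ^ 2) :=
      (continuous_iff_continuousAt.2 fun x => (hu x).continuousAt).pow 2
    have hI : IntegrableOn (fun x => (χ x - l * φ x) ^ 2) (Iic t0) := by
      have hexp : IntegrableOn (fun x => 1 / 2 * exp (-(2 * t0)) * exp (2 * x)) (Iic t0) :=
        (integrableOn_exp_mul_Iic (by norm_num) t0).const_mul _
      refine Integrable.mono' hexp hcont.aestronglyMeasurable.restrict ?_
      refine (ae_restrict_iff' measurableSet_Iic).2 (Eventually.of_forall fun x hx => ?_)
      have hx' : x ≤ t0 := hx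
      have hg := hGpos x hx'
      rw [Real.norm_eq_abs, abs_of_nonneg (sq_nonneg _)]
      have e : (χ x - l * φ x) ^ 2 = G x * (r x - l) ^ 2 := by
        have := hφne x hx'
        simp only [hG, hr]; field_simp
      have h1 := hl1 x hx'
      have h2 := hl2 x hx'
      have h3 := hGe x hx'
      have h4 : (r x - l) ^ 2 ≤ (1 / 2 * (G x)⁻¹) ^ 2 :=
        pow_le_pow_left₀ (by linarith) (by linarith) 2
      calc (χ x - l * φ x) ^ 2 = G x * (r x - l) ^ 2 := e
        _ ≤ G x * (1 / 2 * (G x)⁻¹) ^ 2 := by gcongr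
        _ = 1 / 4 * (G x)⁻¹ := by field_simp; norm_num
        _ ≤ 1 / 2 * exp (-(2 * t0)) * exp (2 * x) := by
          rw [← div_eq_mul_inv, div_le_iff₀ hg]
          have : exp (-(2 * t0)) * exp (2 * t0) = 1 := by rw [← exp_add]; simp
          nlinarith [exp_pos (-(2 * t0))]
    have : IntegrableOn (fun x => (χ x - l * φ x) ^ 2) (Iic t0 ∪ Icc t0 b) :=
      hI.union (hcont.integrableOn_Icc)
    refine this.mono_set fun x hx => ?_
    rcases le_total x t0 with h | h
    · exact Or.inl h
    · exact Or.inr ⟨h, hx⟩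

/-- `h` is eventually dominated by the derivative of a bounded function. -/
def StkBP (h : ℝ → ℝ) : Prop :=
  ∃ S S' : ℝ → ℝ, ∃ M : ℝ, ∀ᶠ x in atTop, HasDerivAt S (S' x) x ∧ h x ≤ S' x ∧ |S x| ≤ M

theorem StkBP.add {f g : ℝ → ℝ} (hf : StkBP f) (hg : StkBP g) : StkBP (fun x => f x + g x) := by
  obtain ⟨S, S', M, h⟩ := hf
  obtain ⟨T, T', M2, h2⟩ := hg
  refine ⟨fun x => S x + T x, fun x => S' x + T' x, M + M2, ?_⟩
  filter_upwards [h, h2] with x a b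
  exact ⟨a.1.add b.1, add_le_add a.2.1 b.2.1, (abs_add_le _ _).trans (add_le_add a.2.2 b.2.2)⟩

theorem StkBP.mono {f g : ℝ → ℝ} (hg : StkBP g) (h : ∀ᶠ x in atTop, f x ≤ g x) : StkBP f := by
  obtain ⟨S, S', M, h2⟩ := hg
  refine ⟨S, S', M, ?_⟩
  filter_upwards [h, h2] with x a b
  exact ⟨b.1, a.trans b.2.1, b.2.2⟩

theorem StkBP.zero : StkBP (fun _ => 0) :=
  ⟨fun _ => 0, fun _ => 0, 0, Eventually.of_forall fun x => ⟨hasDerivAt_const _ _, le_rfl, by simp⟩⟩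

theorem StkBP.sum {ι : Type*} (s : Finset ι) (f : ι → ℝ → ℝ) (h : ∀ i ∈ s, StkBP (f i)) :
    StkBP (fun x => ∑ i ∈ s, f i x) := by
  classical
  induction s using Finset.induction_on with
  | empty => simpa using StkBP.zero
  | insert a s ha ih =>
    have := (h a (by simp)).add (ih fun i hi => h i (by simp [hi]))
    simpa [Finset.sum_insert ha] using this

theorem StkBP.err {f : ℝ → ℝ} {δ M : ℝ} (hδ : 0 < δ) (h : ∀ᶠ x in atTop, f x ≤ M * x ^ (-1 - δ)) :
    StkBP f := by
  refine ⟨fun x => -(M / δ) * x ^ (-δ), fun x => M * x ^ (-1 - δ), |M / δ|, ?_⟩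
  filter_upwards [h, eventually_ge_atTop 1] with x hx h1
  have h0 : 0 < x := by linarith
  refine ⟨?_, hx, ?_⟩
  · refine ((hasDerivAt_rpow_const (p := -δ) (Or.inl h0.ne')).const_mul (-(M / δ))).congr_deriv ?_
    rw [show -δ - 1 = -1 - δ by ring]
    field_simp
  · rw [abs_mul, abs_neg]
    have : |x ^ (-δ)| ≤ 1 := by
      rw [abs_of_nonneg (by positivity)]
      exact rpow_le_one_of_one_le_of_nonpos h1 (by linarith)
    nlinarith [abs_nonneg (M / δ)]

theorem StkBP.osc {D D' Φ Φ' : ℝ → ℝ} {δ M s m : ℝ} (hδ : 0 < δ) (hs : δ ≤ 1 + s) (hm : m ≠ 0)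
    (hD : ∀ᶠ x in atTop, HasDerivAt D (D' x) x) (hΦ : ∀ᶠ x in atTop, HasDerivAt Φ (Φ' x) x)
    (hDb : ∀ᶠ x in atTop, |D x| ≤ M) (hDb' : ∀ᶠ x in atTop, |D' x| ≤ M / x)
    (hph : ∀ᶠ x in atTop, |Φ' x - m * x ^ s| ≤ M * x ^ (s - δ)) :
    StkBP (fun x => D x / x * cos (Φ x)) := by
  set b : ℝ → ℝ := fun x => x ^ (-1 - s) / m with hb
  set b' : ℝ → ℝ := fun x => ((-1 - s) * x ^ (-1 - s - 1)) / m with hb'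
  set T : ℝ → ℝ := fun x => (D' x * b x + D x * b' x) * sin (Φ x) + D x * b x * (cos (Φ x) * Φ' x)
    with hT
  have hM0 : 0 ≤ M := by
    obtain ⟨x, hx⟩ := hDb.exists
    exact (abs_nonneg _).trans hx
  have h1 : StkBP T := by
    refine ⟨fun x => D x * b x * sin (Φ x), T, M * (1 / |m|), ?_⟩
    filter_upwards [hD, hΦ, hDb, eventually_ge_atTop 1] with x a1 a2 a3 a4
    have h0 : 0 < x := by linarith
    refine ⟨?_, le_rfl, ?_⟩
    · have hbd : HasDerivAt b (b' x) x :=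
        (hasDerivAt_rpow_const (p := -1 - s) (Or.inl h0.ne')).div_const m
      exact (a1.mul hbd).mul a2.sin
    · rw [abs_mul, abs_mul]
      have e1 : |b x| ≤ 1 / |m| := by
        rw [hb, abs_div, abs_of_nonneg (by positivity)]
        gcongr
        exact rpow_le_one_of_one_le_of_nonpos a4 (by linarith)
      calc |D x| * |b x| * |sin (Φ x)| ≤ M * (1 / |m|) * 1 := by
            gcongr
            exact abs_sin_le_one _
        _ = _ := by ring
  have h2 : StkBP (fun x => D x / x * cos (Φ x) - T x) := by
    refine StkBP.err (M := M * (M / |m|) + M / |m| + M * (|(-1 - s)| / |m|)) hδ ?_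
    filter_upwards [hDb, hDb', hph, eventually_ge_atTop 1] with x a1 a2 a3 a4
    have h0 : 0 < x := by linarith
    have hmp : 0 < |m| := abs_pos.2 hm
    set z := x ^ (-1 - δ) with hz
    have hz0 : 0 < z := by positivity
    have e : D x / x * cos (Φ x) - T x
        = -(D x * (b x * (Φ' x - m * x ^ s)) * cos (Φ x)) - D' x * b x * sin (Φ x)
          - D x * b' x * sin (Φ x) := by
      have : 1 / x = b x * (m * x ^ s) := by
        simp only [hb]
        rw [div_mul_eq_mul_div, mul_comm m, ← mul_assoc, mul_div_assoc, div_self hm, mul_one,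
          ← rpow_add h0]
        rw [show -1 - s + s = (-1:ℝ) by ring, rpow_neg_one, one_div]
      rw [div_eq_mul_one_div, this]
      simp only [hT]; ring
    have k1 : |b x * (Φ' x - m * x ^ s)| ≤ M / |m| * z := by
      rw [abs_mul]
      simp only [hb]
      rw [abs_div, abs_of_nonneg (by positivity : 0 ≤ x ^ (-1 - s))]
      calc x ^ (-1 - s) / |m| * |Φ' x - m * x ^ s| ≤ x ^ (-1 - s) / |m| * (M * x ^ (s - δ)) := by gcongr
        _ = M / |m| * (x ^ (-1 - s) * x ^ (s - δ)) := by ring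
        _ = _ := by rw [← rpow_add h0, hz]; congr 2; ring
    have k2 : |D' x * b x| ≤ M / |m| * z := by
      rw [abs_mul]
      simp only [hb]
      rw [abs_div, abs_of_nonneg (by positivity : 0 ≤ x ^ (-1 - s))]
      calc |D' x| * (x ^ (-1 - s) / |m|) ≤ M / x * (x ^ (-1 - s) / |m|) := by gcongr
        _ = M / |m| * (x ^ (-1 : ℝ) * x ^ (-1 - s)) := by rw [rpow_neg_one]; ring
        _ ≤ M / |m| * z := by
          rw [← rpow_add h0, hz]
          gcongr
          linarith
    have k3 : |b' x| ≤ |(-1 - s)| / |m| * z := by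
      simp only [hb']
      rw [abs_div, abs_mul, abs_of_nonneg (by positivity : 0 ≤ x ^ (-1 - s - 1))]
      calc |-1 - s| * x ^ (-1 - s - 1) / |m| ≤ |-1 - s| * z / |m| := by
            have : x ^ (-1 - s - 1) ≤ z := rpow_le_rpow_of_exponent_le a4 (by linarith)
            gcongr
        _ = _ := by ring
    have hcs := abs_cos_le_one (Φ x)
    have hsn := abs_sin_le_one (Φ x)
    rw [e]
    refine (le_abs_self _).trans ?_
    calc |-(D x * (b x * (Φ' x - m * x ^ s)) * cos (Φ x)) - D' x * b x * sin (Φ x)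
          - D x * b' x * sin (Φ x)|
        ≤ |D x * (b x * (Φ' x - m * x ^ s)) * cos (Φ x)| + |D' x * b x * sin (Φ x)|
          + |D x * b' x * sin (Φ x)| := by
          refine (abs_sub _ _).trans (add_le_add ((abs_sub _ _).trans ?_) le_rfl)
          rw [abs_neg]
      _ = |D x| * |b x * (Φ' x - m * x ^ s)| * |cos (Φ x)| + |D' x * b x| * |sin (Φ x)|
          + |D x| * |b' x| * |sin (Φ x)| := by
          rw [abs_mul (D x * _), abs_mul (D x), abs_mul (D' x * b x), abs_mul (D x * b' x), abs_mul (D x) (b' x)]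
      _ ≤ M * (M / |m| * z) * 1 + M / |m| * z * 1 + M * (|-1 - s| / |m| * z) * 1 := by gcongr
      _ = _ := by ring
  refine (h1.add h2).mono (Eventually.of_forall fun x => ?_)
  simp

/-- consequences -/
theorem StkBP.bound {L L' h g g' : ℝ → ℝ} (hh : StkBP h)
    (hL : ∀ᶠ x in atTop, HasDerivAt L (L' x) x) (hg : ∀ᶠ x in atTop, HasDerivAt g (g' x) x)
    (hle : ∀ᶠ x in atTop, L' x ≤ g' x + h x) :
    ∃ K : ℝ, ∀ᶠ x in atTop, L x ≤ K + g x := by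
  obtain ⟨S, S', M, hS⟩ := hh
  obtain ⟨X, hX⟩ := eventually_atTop.1 (hL.and (hg.and (hle.and hS)))
  have hd : ∀ x ≥ X, HasDerivAt (fun x => L x - g x - S x) (L' x - g' x - S' x) x := fun x hx =>
    (((hX x hx).1.sub (hX x hx).2.1)).sub (hX x hx).2.2.2.1
  have hm : AntitoneOn (fun x => L x - g x - S x) (Ici X) := by
    refine antitoneOn_of_hasDerivWithinAt_nonpos (convex_Ici X)
      (fun x hx => (hd x hx).continuousAt.continuousWithinAt)
      (f' := fun x => L' x - g' x - S' x)
      (fun x hx => (hd x (interior_subset (s := Ici X) hx)).hasDerivWithinAt) ?_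
    intro x hx
    obtain ⟨_, _, h1, _, h2, _⟩ := hX x (interior_subset (s := Ici X) hx)
    linarith
  refine ⟨L X - g X - S X + M, eventually_atTop.2 ⟨X, fun x hx => ?_⟩⟩
  have h1 := hm (mem_Ici.2 le_rfl) (mem_Ici.2 hx) hx
  have h2 := (abs_le.1 (hX x hx).2.2.2.2.2).2
  simp only at h1
  linarith

/-- The modified wave number. -/
noncomputable def stkP (α E x : ℝ) : ℝ := sqrt (x ^ α + E)

noncomputable def stkP' (α E x : ℝ) : ℝ := α * x ^ (α - 1) / (2 * stkP α E x)

theorem stkP_facts (α E : ℝ) (hα : 0 < α) : ∃ M : ℝ, 0 ≤ M ∧ ∀ᶠ x in atTop,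
    HasDerivAt (stkP α E) (stkP' α E x) x ∧ x ^ (α / 2) / 2 ≤ stkP α E x ∧
    |stkP α E x - x ^ (α / 2)| ≤ M * x ^ (-(α / 2)) ∧
    |x ^ (α / 2) / stkP α E x - 1| ≤ M * x ^ (-α) ∧
    |stkP' α E x / (2 * stkP α E x) - α / 4 / x| ≤ M * x ^ (-1 - α) ∧
    |stkP' α E x / stkP α E x| ≤ M / x := by
  refine ⟨(2 + α) * |E| + α, by positivity, ?_⟩
  filter_upwards [eventually_ge_atTop 1, (tendsto_rpow_atTop hα).eventually_ge_atTop (2 * |E| + 1)]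
    with x h1 h2
  have h0 : 0 < x := by linarith
  set y := x ^ (α / 2) with hy
  have hy0 : 0 < y := by positivity
  have hyy : x ^ α = y ^ 2 := by rw [hy, ← rpow_natCast, ← rpow_mul h0.le]; norm_num
  have hyi : x ^ (-(α / 2)) = y⁻¹ := rpow_neg h0.le _
  have hyyi : x ^ (-α) = (y ^ 2)⁻¹ := by rw [rpow_neg h0.le, hyy]
  have hx1 : x ^ (-1 - α) = x⁻¹ * (y ^ 2)⁻¹ := by
    rw [sub_eq_add_neg, rpow_add h0, hyyi, rpow_neg_one]
  have hxa : x ^ (α - 1) = y ^ 2 * x⁻¹ := by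
    rw [sub_eq_add_neg, rpow_add h0, hyy, rpow_neg_one]
  have hE1 := neg_abs_le E
  have hE2 := le_abs_self E
  have hE0 := abs_nonneg E
  rw [hyy] at h2
  have hpos : 0 < y ^ 2 + E := by linarith
  have hPP : stkP α E x ^ 2 = y ^ 2 + E := by rw [stkP, hyy, sq_sqrt hpos.le]
  have hP0 : 0 < stkP α E x := by rw [stkP, hyy]; exact sqrt_pos.2 hpos
  have hPd : HasDerivAt (stkP α E) (stkP' α E x) x := by
    have := ((hasDerivAt_rpow_const (p := α) (Or.inl h0.ne')).add_const E).sqrt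
      (by rw [hyy]; exact hpos.ne')
    exact this
  have hP' : stkP' α E x = α * (y ^ 2 * x⁻¹) / (2 * stkP α E x) := by rw [stkP', hxa]
  rw [hP'] at hPd ⊢
  rw [hyi, hyyi, hx1]
  clear hP'
  generalize stkP α E x = P at hPP hP0 hPd ⊢
  have hPy : y / 2 ≤ P := by
    refine le_of_sq_le_sq ?_ hP0.le
    nlinarith
  have hPyd : |P - y| ≤ |E| * y⁻¹ := by
    have : (P - y) * (P + y) = E := by nlinarith
    rw [← div_eq_mul_inv, le_div_iff₀ hy0]
    calc |P - y| * y ≤ |P - y| * (P + y) := by gcongr; linarith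
      _ = |E| := by rw [← this, abs_mul, abs_of_pos (by positivity : 0 < P + y)]
  have hPP' : α * (y ^ 2 * x⁻¹) / (2 * P) / (2 * P) = α / 4 / x * (y ^ 2 / (y ^ 2 + E)) := by
    rw [← hPP]; field_simp; norm_num
  refine ⟨hPd, hPy, ?_, ?_, ?_, ?_⟩
  · refine hPyd.trans ?_
    gcongr
    nlinarith
  · have : y / P - 1 = -(P - y) / P := by field_simp; ring
    rw [this, abs_div, abs_neg, abs_of_pos hP0, div_le_iff₀ hP0]
    refine hPyd.trans ?_
    calc |E| * y⁻¹ = 2 * |E| * (y ^ 2)⁻¹ * (y / 2) := by field_simp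
      _ ≤ ((2 + α) * |E| + α) * (y ^ 2)⁻¹ * P := by
        gcongr
        nlinarith
  · rw [hPP']
    have : α / 4 / x * (y ^ 2 / (y ^ 2 + E)) - α / 4 / x = - (α / 4 / x * (E / (y ^ 2 + E))) := by
      field_simp; ring
    rw [this, abs_neg, abs_mul, abs_div E, abs_of_pos (by positivity : 0 < α / 4 / x), abs_of_pos hpos]
    calc α / 4 / x * (|E| / (y ^ 2 + E)) ≤ α / 4 / x * (|E| / (y ^ 2 / 2)) := by
          gcongr; linarith
      _ = (α / 2 * |E|) * (x⁻¹ * (y ^ 2)⁻¹) := by field_simp; ring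
      _ ≤ _ := by
        gcongr
        nlinarith [mul_nonneg hα.le hE0]
  · have : α * (y ^ 2 * x⁻¹) / (2 * P) / P = α / 2 / x * (y ^ 2 / (y ^ 2 + E)) := by
      rw [← hPP]; field_simp
    rw [this, abs_of_pos (by positivity)]
    calc α / 2 / x * (y ^ 2 / (y ^ 2 + E)) ≤ α / 2 / x * (y ^ 2 / (y ^ 2 / 2)) := by
          gcongr; linarith
      _ = α / x := by field_simp
      _ ≤ _ := by
        gcongr
        nlinarith [mul_nonneg hα.le hE0]

theorem stkP_diff (α E F : ℝ) (hα : 0 < α) : ∃ M : ℝ, ∀ᶠ x in atTop,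
    |2 * (stkP α E x - stkP α F x) - (E - F) * x ^ (-(α / 2))| ≤ M * x ^ (-(α / 2) - α) := by
  obtain ⟨M1, hM1, h1⟩ := stkP_facts α E hα
  obtain ⟨M2, hM2, h2⟩ := stkP_facts α F hα
  refine ⟨|E - F| * (M1 + M2), ?_⟩
  filter_upwards [h1, h2, eventually_ge_atTop 1, 
    (tendsto_rpow_atTop hα).eventually_ge_atTop (|E| + |F| + 1)] with x a b hx hl
  have h0 : 0 < x := by linarith
  obtain ⟨-, a1, a2, -⟩ := a
  obtain ⟨-, b1, b2, -⟩ := b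
  set y := x ^ (α / 2) with hy
  have hy0 : 0 < y := by positivity
  have hyi : x ^ (-(α / 2)) = y⁻¹ := rpow_neg h0.le _
  have hyy : x ^ α = y ^ 2 := by rw [hy, ← rpow_natCast, ← rpow_mul h0.le]; norm_num
  have hy3 : x ^ (-(α / 2) - α) = y⁻¹ * (y ^ 2)⁻¹ := by
    rw [sub_eq_add_neg, rpow_add h0, hyi, rpow_neg h0.le, hyy]
  rw [hyi] at a2 b2 ⊢
  rw [hy3]
  have hE : stkP α E x ^ 2 = y ^ 2 + E := by
    rw [stkP, hyy, sq_sqrt]; linarith [neg_abs_le E, abs_nonneg F]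
  have hF : stkP α F x ^ 2 = y ^ 2 + F := by
    rw [stkP, hyy, sq_sqrt]; linarith [neg_abs_le F, abs_nonneg E]
  generalize stkP α E x = P at *
  generalize stkP α F x = Q at *
  have hs : 0 < P + Q := by linarith
  have hy2 : y ≤ P + Q := by linarith
  have e : 2 * (P - Q) - (E - F) * y⁻¹ = (E - F) * (-(P - y) - (Q - y)) / (y * (P + Q)) := by
    have : E - F = (P - Q) * (P + Q) := by linarith [hE, hF, sq P, sq Q, mul_comm P Q]
    rw [this]; field_simp; ring
  rw [e, abs_div, abs_mul, abs_of_pos (by positivity : 0 < y * (P + Q))]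
  have hn : |-(P - y) - (Q - y)| ≤ (M1 + M2) * y⁻¹ := by
    refine (abs_sub _ _).trans ?_
    rw [abs_neg]; linarith
  calc |E - F| * |-(P - y) - (Q - y)| / (y * (P + Q))
      ≤ |E - F| * ((M1 + M2) * y⁻¹) / (y * y) := by gcongr
    _ = _ := by field_simp

theorem stk_decay {N : ℕ} (α : ℝ) (hα0 : 0 < α) (hα2 : α < 2) (E : Fin N → ℝ)
    (hE : Function.Injective E) (θ : Fin N → ℝ → ℝ) (q : ℝ → ℝ)
    (hq : ∀ᶠ x in atTop, q x = -((2 - α + 4 / log x) * x ^ (α / 2) / x) * ∑ i, sin (2 * θ i x))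
    (hθ : ∀ j, ∀ᶠ x in atTop, HasDerivAt (θ j) (stkP α (E j) x
      + stkP' α (E j) x / stkP α (E j) x * (sin (θ j x) * cos (θ j x))
      - q x / stkP α (E j) x * sin (θ j x) ^ 2) x)
    (j : Fin N) (L : ℝ → ℝ)
    (hL : ∀ᶠ x in atTop, HasDerivAt L (-(stkP' α (E j) x / (2 * stkP α (E j) x)) * cos (2 * θ j x)
      + q x / (2 * stkP α (E j) x) * sin (2 * θ j x)) x) :
    ∃ K : ℝ, ∀ᶠ x in atTop, L x ≤ K + (-((2 - α) / 4) * log x - log (log x)) := by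
  set δ := min α (1 - α / 2) with hδdef
  have hδ : 0 < δ := lt_min hα0 (by linarith)
  have hδ1 : δ ≤ α := min_le_left _ _
  have hδ2 : δ ≤ 1 - α / 2 := min_le_right _ _
  set C : ℝ → ℝ := fun x => 2 - α + 4 / log x with hC
  set θ' : Fin N → ℝ → ℝ := fun j x => stkP α (E j) x
      + stkP' α (E j) x / stkP α (E j) x * (sin (θ j x) * cos (θ j x))
      - q x / stkP α (E j) x * sin (θ j x) ^ 2 with hθ'
  have hlog : ∀ᶠ x in atTop, 1 ≤ log x := tendsto_log_atTop.eventually_ge_atTop 1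
  have hCb : ∀ᶠ x in atTop, |C x| ≤ 6 := by
    filter_upwards [hlog] with x hx
    have : 4 / log x ≤ 4 := div_le_self (by norm_num) hx
    have : 0 ≤ 4 / log x := by positivity
    simp only [hC]
    rw [abs_le]; constructor <;> linarith
  have hCd : ∀ᶠ x in atTop, HasDerivAt C (4 * (-x⁻¹ / log x ^ 2)) x := by
    filter_upwards [hlog, eventually_ge_atTop 1] with x hx h1
    have := (((hasDerivAt_log (by linarith : x ≠ 0)).inv (by linarith : log x ≠ 0)).const_mul 4).const_add (2 - α)
    exact this
  have hCb' : ∀ᶠ x in atTop, |4 * (-x⁻¹ / log x ^ 2)| ≤ 6 / x := by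
    filter_upwards [hlog, eventually_ge_atTop 1] with x hx h1
    have h0 : 0 < x := by linarith
    rw [abs_mul, abs_div, abs_neg, abs_of_pos (by positivity : 0 < x⁻¹), abs_of_nonneg (sq_nonneg (log x)),
      abs_of_pos (by norm_num : (0:ℝ) < 4), div_eq_mul_inv 6]
    have : x⁻¹ / log x ^ 2 ≤ x⁻¹ := div_le_self (by positivity) (by nlinarith)
    have : 0 < x⁻¹ := by positivity
    linarith
  have hsum : ∀ x, |∑ i, sin (2 * θ i x)| ≤ N := by
    intro x
    refine (Finset.abs_sum_le_sum_abs _ _).trans ?_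
    refine (Finset.sum_le_sum fun i _ => abs_sin_le_one _).trans ?_
    simp
  -- angle derivative
  have hθP : ∀ j, ∃ M, 0 ≤ M ∧ ∀ᶠ x in atTop, |θ' j x - stkP α (E j) x| ≤ M / x := by
    intro j
    obtain ⟨M, hM, h⟩ := stkP_facts α (E j) hα0
    refine ⟨M + 12 * N, by positivity, ?_⟩
    filter_upwards [h, hq, hCb, eventually_ge_atTop 1] with x a hqx hCx h1
    have h0 : 0 < x := by linarith
    obtain ⟨-, a1, -, -, -, a2⟩ := a
    have hy : 0 < x ^ (α / 2) := by positivity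
    have hP : 0 < stkP α (E j) x := by linarith
    have e : θ' j x - stkP α (E j) x = stkP' α (E j) x / stkP α (E j) x * (sin (θ j x) * cos (θ j x))
      - q x / stkP α (E j) x * sin (θ j x) ^ 2 := by simp only [hθ']; ring
    rw [e]
    have b1 : |sin (θ j x) * cos (θ j x)| ≤ 1 := by
      rw [abs_mul]
      exact mul_le_one₀ (abs_sin_le_one _) (abs_nonneg _) (abs_cos_le_one _)
    have b2 : |sin (θ j x) ^ 2| ≤ 1 := by
      rw [abs_of_nonneg (sq_nonneg _)]; exact sin_sq_le_one _
    have b3 : |q x / stkP α (E j) x| ≤ 12 * N / x := by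
      rw [hqx, abs_div, abs_mul, abs_neg, abs_div, abs_mul, abs_of_pos hP, abs_of_pos h0, abs_of_pos hy,
        div_le_iff₀ hP]
      calc |2 - α + 4 / log x| * x ^ (α / 2) / x * |∑ i, sin (2 * θ i x)|
          ≤ 6 * x ^ (α / 2) / x * N := by gcongr; exact hsum x
        _ = 12 * N / x * (x ^ (α / 2) / 2) := by ring
        _ ≤ _ := by gcongr
    refine (abs_sub _ _).trans ?_
    rw [abs_mul (stkP' α (E j) x / stkP α (E j) x), abs_mul (q x / stkP α (E j) x), add_div]
    refine add_le_add ?_ ?_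
    · calc _ ≤ M / x * 1 := by gcongr
        _ = _ := mul_one _
    · calc _ ≤ 12 * N / x * 1 := by gcongr
        _ = _ := mul_one _
  have hθd : ∀ j, ∀ᶠ x in atTop, HasDerivAt (θ j) (θ' j x) x := hθ
  -- fast phases
  have hfast : ∀ j, ∃ M, 0 ≤ M ∧ ∀ᶠ x in atTop, |θ' j x - x ^ (α / 2)| ≤ M * x ^ (α / 2 - δ) := by
    intro j
    obtain ⟨M, hM, h⟩ := stkP_facts α (E j) hα0
    obtain ⟨M2, hM2, h2⟩ := hθP j
    refine ⟨M2 + M, by positivity, ?_⟩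
    filter_upwards [h, h2, eventually_ge_atTop 1] with x a b h1
    have h0 : 0 < x := by linarith
    obtain ⟨-, -, a1, -⟩ := a
    have e : θ' j x - x ^ (α / 2) = (θ' j x - stkP α (E j) x) + (stkP α (E j) x - x ^ (α / 2)) := by ring
    rw [e]
    refine (abs_add_le _ _).trans ?_
    rw [add_mul]
    refine add_le_add (b.trans ?_) (a1.trans ?_)
    · rw [div_eq_mul_inv, ← rpow_neg_one]
      gcongr
      linarith
    · gcongr
      linarith
  have hosc2 : ∀ i j, StkBP (fun x => C x / 4 / x * cos (2 * θ i x + 2 * θ j x)) := by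
    intro i j
    obtain ⟨M1, hM1, h1⟩ := hfast i
    obtain ⟨M2, hM2, h2⟩ := hfast j
    refine StkBP.osc (D := fun x => C x / 4) (Φ := fun x => 2 * θ i x + 2 * θ j x)
      (Φ' := fun x => 2 * θ' i x + 2 * θ' j x) (s := α / 2) (m := 4)
      (M := 2 * M1 + 2 * M2 + 6) hδ (by linarith) (by norm_num)
      (hCd.mono fun x hx => hx.div_const 4) ?_ ?_ ?_ ?_
    · filter_upwards [hθd i, hθd j] with x a b
      exact (a.const_mul 2).add (b.const_mul 2)
    · filter_upwards [hCb] with x hx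
      rw [abs_div, abs_of_pos (by norm_num : (0:ℝ) < 4)]
      linarith [abs_nonneg (C x)]
    · filter_upwards [hCb', eventually_ge_atTop 1] with x hx h1
      rw [abs_div, abs_of_pos (by norm_num : (0:ℝ) < 4)]
      have h0 : 0 < x := by linarith
      have : 0 ≤ (2 * M1 + 2 * M2) / x := by positivity
      rw [add_div]
      linarith [abs_nonneg (4 * (-x⁻¹ / log x ^ 2))]
    · filter_upwards [h1, h2, eventually_ge_atTop 1] with x a b h1
      have h0 : 0 < x := by linarith
      have hz : 0 < x ^ (α / 2 - δ) := by positivity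
      rw [abs_le] at a b ⊢
      constructor <;> nlinarith
  have hosc1 : StkBP (fun x => (-(α / 4)) / x * cos (2 * θ j x)) := by
    obtain ⟨M1, hM1, h1⟩ := hfast j
    refine StkBP.osc (D := fun x => -(α / 4)) (D' := fun _ => 0) (Φ := fun x => 2 * θ j x)
      (Φ' := fun x => 2 * θ' j x) (s := α / 2) (m := 2)
      (M := 2 * M1 + α) hδ (by linarith) (by norm_num)
      (Eventually.of_forall fun x => hasDerivAt_const _ _) ?_ ?_ ?_ ?_
    · filter_upwards [hθd j] with x a
      exact (a.const_mul 2)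
    · refine Eventually.of_forall fun x => ?_
      rw [abs_neg, abs_of_pos (by positivity)]
      linarith
    · filter_upwards [eventually_ge_atTop 1] with x h1
      rw [abs_zero]
      have h0 : 0 < x := by linarith
      positivity
    · filter_upwards [h1, eventually_ge_atTop 1] with x a h1
      have h0 : 0 < x := by linarith
      have hz : 0 < x ^ (α / 2 - δ) := by positivity
      rw [abs_le] at a ⊢
      constructor <;> nlinarith
  have hosc0 : ∀ i, i ≠ j → StkBP (fun x => (-(C x / 4)) / x * cos (2 * θ i x - 2 * θ j x)) := by
    intro i hij
    obtain ⟨M1, hM1, h1⟩ := hθP i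
    obtain ⟨M2, hM2, h2⟩ := hθP j
    obtain ⟨M3, h3⟩ := stkP_diff α (E i) (E j) hα0
    refine StkBP.osc (D := fun x => -(C x / 4)) (D' := fun x => -((4 * (-x⁻¹ / log x ^ 2)) / 4))
      (Φ := fun x => 2 * θ i x - 2 * θ j x)
      (Φ' := fun x => 2 * θ' i x - 2 * θ' j x) (s := -(α / 2)) (m := E i - E j)
      (M := 2 * M1 + 2 * M2 + |M3| + 6) hδ (by linarith) (sub_ne_zero.2 (hE.ne hij))
      (hCd.mono fun x hx => (hx.div_const 4).neg) ?_ ?_ ?_ ?_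
    · filter_upwards [hθd i, hθd j] with x a b
      exact (a.const_mul 2).sub (b.const_mul 2)
    · filter_upwards [hCb] with x hx
      rw [abs_neg, abs_div, abs_of_pos (by norm_num : (0:ℝ) < 4)]
      linarith [abs_nonneg (C x), abs_nonneg M3]
    · filter_upwards [hCb', eventually_ge_atTop 1] with x hx h1
      rw [abs_neg, abs_div, abs_of_pos (by norm_num : (0:ℝ) < 4)]
      have h0 : 0 < x := by linarith
      have : 0 ≤ (2 * M1 + 2 * M2 + |M3|) / x := by positivity
      rw [add_div]
      linarith [abs_nonneg (4 * (-x⁻¹ / log x ^ 2))]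
    · filter_upwards [h1, h2, h3, eventually_ge_atTop 1] with x a b c h1
      have h0 : 0 < x := by linarith
      have hz : 0 < x ^ (-(α / 2) - δ) := by positivity
      have k1 : x⁻¹ ≤ x ^ (-(α / 2) - δ) := by
        rw [← rpow_neg_one]
        exact rpow_le_rpow_of_exponent_le h1 (by linarith)
      have k2 : x ^ (-(α / 2) - α) ≤ x ^ (-(α / 2) - δ) :=
        rpow_le_rpow_of_exponent_le h1 (by linarith)
      rw [div_eq_mul_inv] at a b
      have a' := a.trans (mul_le_mul_of_nonneg_left k1 hM1)
      have b' := b.trans (mul_le_mul_of_nonneg_left k1 hM2)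
      have c' : _ ≤ |M3| * x ^ (-(α / 2) - δ) := c.trans (mul_le_mul (le_abs_self M3) k2 (by positivity) (abs_nonneg _))
      rw [abs_le] at a' b' c' ⊢
      constructor <;> nlinarith
  -- assemble
  set A : ℝ → ℝ := fun x => (-(α / 4)) / x * cos (2 * θ j x) +
    ∑ i, C x / 4 / x * cos (2 * θ i x + 2 * θ j x) +
    ∑ i ∈ Finset.univ.erase j, (-(C x / 4)) / x * cos (2 * θ i x - 2 * θ j x) with hA
  have hAB : StkBP A := (hosc1.add (StkBP.sum _ _ fun i _ => hosc2 i j)).add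
    (StkBP.sum _ _ fun i hi => hosc0 i (Finset.ne_of_mem_erase hi))
  set g' : ℝ → ℝ := fun x => -((2 - α) / 4) * x⁻¹ - x⁻¹ / log x with hg'
  set L' : ℝ → ℝ := fun x => -(stkP' α (E j) x / (2 * stkP α (E j) x)) * cos (2 * θ j x)
      + q x / (2 * stkP α (E j) x) * sin (2 * θ j x) with hL'
  have herr : StkBP (fun x => L' x - g' x - A x) := by
    obtain ⟨M, hM, h⟩ := stkP_facts α (E j) hα0
    refine StkBP.err (δ := δ) (M := M + 3 * M * N) hδ ?_
    filter_upwards [h, hq, hCb, hlog, eventually_ge_atTop 1] with x a hqx hCx hlx h1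
    have h0 : 0 < x := by linarith
    obtain ⟨-, a1, -, a2, a3, -⟩ := a
    have hy : 0 < x ^ (α / 2) := by positivity
    have hP : 0 < stkP α (E j) x := by linarith
    have hg : g' x = -(C x / 4 / x) := by
      simp only [hg', hC]; field_simp; ring
    have hss : ∑ i, C x / 4 / x * cos (2 * θ i x + 2 * θ j x) +
        ∑ i ∈ Finset.univ.erase j, (-(C x / 4)) / x * cos (2 * θ i x - 2 * θ j x)
        = C x / 4 / x - C x / 2 / x * (∑ i, sin (2 * θ i x)) * sin (2 * θ j x) := by
      have e1 := Finset.add_sum_erase Finset.univ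
        (fun i => (-(C x / 4)) / x * cos (2 * θ i x - 2 * θ j x)) (Finset.mem_univ j)
      simp only [sub_self, cos_zero, mul_one] at e1
      have e2 : ∑ i ∈ Finset.univ.erase j, (-(C x / 4)) / x * cos (2 * θ i x - 2 * θ j x)
        = C x / 4 / x + ∑ i, (-(C x / 4)) / x * cos (2 * θ i x - 2 * θ j x) := by
        rw [← e1]; ring
      rw [e2, add_left_comm, ← Finset.sum_add_distrib, sub_eq_add_neg]
      congr 1
      rw [Finset.mul_sum, Finset.sum_mul, ← Finset.sum_neg_distrib]
      refine Finset.sum_congr rfl fun i _ => ?_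
      rw [cos_add, cos_sub]; ring
    have e : L' x - g' x - A x
        = -((stkP' α (E j) x / (2 * stkP α (E j) x) - α / 4 / x) * cos (2 * θ j x))
          - C x / 2 / x * (x ^ (α / 2) / stkP α (E j) x - 1) * (∑ i, sin (2 * θ i x)) * sin (2 * θ j x) := by
      simp only [hA]
      rw [add_assoc, hss, hg]
      simp only [hL']
      rw [hqx]
      change _ + (-(C x * _ / x) * _) / _ * _ - _ - _ = _
      ring
    rw [e]
    have hz : x ^ (-1 - α) ≤ x ^ (-1 - δ) := rpow_le_rpow_of_exponent_le h1 (by linarith)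
    have hz2 : x ^ (-α) / x = x ^ (-1 - α) := by
      rw [div_eq_mul_inv, ← rpow_neg_one, ← rpow_add h0]; congr 1; ring
    refine (le_abs_self _).trans ((abs_sub _ _).trans ?_)
    rw [abs_neg, abs_mul, abs_mul (_ * _) (sin _), abs_mul (_ * _) (∑ i, _), abs_mul (C x / 2 / x), abs_div,
      abs_div, abs_of_pos h0, abs_of_pos (by norm_num : (0:ℝ) < 2), add_mul]
    have hs := hsum x
    have hs1 := abs_sin_le_one (2 * θ j x)
    have hs2 := abs_cos_le_one (2 * θ j x)
    refine add_le_add ?_ ?_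
    · calc _ ≤ (M * x ^ (-1 - α)) * 1 := by gcongr
        _ ≤ _ := by rw [mul_one]; gcongr
    · calc _ ≤ 6 / 2 / x * (M * x ^ (-α)) * N * 1 := by gcongr
        _ = 3 * M * N * (x ^ (-α) / x) := by ring
        _ ≤ _ := by rw [hz2]; gcongr
  refine StkBP.bound (hAB.add herr) (L' := L') (g' := g') hL ?_ (Eventually.of_forall fun x => ?_)
  · filter_upwards [hlog, eventually_ge_atTop 1] with x hx h1
    have h0 : x ≠ 0 := by linarith
    exact ((hasDerivAt_log h0).const_mul _).sub ((hasDerivAt_log h0).log (by linarith))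
  · linarith

theorem stk_bdd {ι : Type*} [Finite ι] (a : ι → ℝ → ℝ) (ha : ∀ i, Continuous (a i)) (t0 T : ℝ) :
    ∃ M, 0 ≤ M ∧ ∀ i t, |t - t0| ≤ T → |a i t| ≤ M := by
  have : ∀ i, ∃ M, ∀ t ∈ Icc (t0 - T) (t0 + T), ‖a i t‖ ≤ M := fun i =>
    isCompact_Icc.exists_bound_of_continuousOn (ha i).continuousOn
  choose M hM using this
  obtain ⟨B, hB⟩ := (Set.finite_range M).bddAbove
  refine ⟨|B|, abs_nonneg _, fun i t ht => ?_⟩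
  rw [abs_le] at ht
  exact (hM i t ⟨by linarith, by linarith⟩).trans ((hB ⟨i, rfl⟩).trans (le_abs_self B))

theorem stk_loop {N : ℕ} (a b c : Fin N → ℝ → ℝ) (ha : ∀ i, Continuous (a i))
    (hb : ∀ i, Continuous (b i)) (hc : ∀ i, Continuous (c i)) (t0 : ℝ) (y0 : Fin N → ℝ) :
    ∃ θ : Fin N → ℝ → ℝ, (∀ j, θ j t0 = y0 j) ∧ ∀ j t, HasDerivAt (θ j)
      (a j t + b j t * (sin (θ j t) * cos (θ j t)) +
        c j t * (∑ i, sin (2 * θ i t)) * sin (θ j t) ^ 2) t := by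
  have hsum : ∀ y : Fin N → ℝ, |∑ i, sin (2 * y i)| ≤ N := by
    intro x
    refine (Finset.abs_sum_le_sum_abs _ _).trans ?_
    refine (Finset.sum_le_sum fun i _ => abs_sin_le_one _).trans ?_
    simp
  have hsc : ∀ x : ℝ, |sin x * cos x| ≤ 1 := fun x => by
    rw [abs_mul]; exact mul_le_one₀ (abs_sin_le_one _) (abs_nonneg _) (abs_cos_le_one _)
  have hs2 : ∀ x : ℝ, |sin x ^ 2| ≤ 1 := fun x => by
    rw [abs_of_nonneg (sq_nonneg _)]; exact sin_sq_le_one _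
  have hsl : ∀ x y : ℝ, |sin x - sin y| ≤ |x - y| := fun x y => by
    simpa [Real.dist_eq] using (lipschitzWith_sin.dist_le_mul x y)
  have hscl : ∀ x y : ℝ, |sin x * cos x - sin y * cos y| ≤ |x - y| := fun x y => by
    have h := hsl (2 * x) (2 * y)
    rw [sin_two_mul, sin_two_mul] at h
    rw [show 2 * sin x * cos x - 2 * sin y * cos y = 2 * (sin x * cos x - sin y * cos y) by ring,
      show 2 * x - 2 * y = 2 * (x - y) by ring, abs_mul, abs_mul, abs_of_pos (by norm_num : (0:ℝ) < 2)] at h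
    linarith
  have hs2l : ∀ x y : ℝ, |sin x ^ 2 - sin y ^ 2| ≤ 2 * |x - y| := fun x y => by
    rw [show sin x ^ 2 - sin y ^ 2 = (sin x + sin y) * (sin x - sin y) by ring, abs_mul]
    have h2 : |sin x + sin y| ≤ 2 := by
      have := abs_add_le (sin x) (sin y); linarith [abs_sin_le_one x, abs_sin_le_one y]
    exact mul_le_mul h2 (hsl x y) (abs_nonneg _) (by norm_num)
  obtain ⟨θ, h0, hθ⟩ := stk_global_ode (V := Fin N → ℝ) (fun t y j =>
      a j t + b j t * (sin (y j) * cos (y j)) + c j t * (∑ i, sin (2 * y i)) * sin (y j) ^ 2) t0 y0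
    (fun x => by
      refine continuous_pi fun j => ?_
      have := ha j; have := hb j; have := hc j
      fun_prop) (by
    intro T
    obtain ⟨A, hA0, hA⟩ := stk_bdd a ha t0 T
    obtain ⟨B, hB0, hB⟩ := stk_bdd b hb t0 T
    obtain ⟨C, hC0, hC⟩ := stk_bdd c hc t0 T
    refine ⟨⟨A + B + C * N, by positivity⟩, ⟨B + C * N * 4, by positivity⟩, fun t ht => ⟨fun x => ?_, ?_⟩⟩
    · refine (pi_norm_le_iff_of_nonneg (NNReal.coe_nonneg _)).2 fun j => ?_
      rw [Real.norm_eq_abs]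
      refine (abs_add_le _ _).trans (add_le_add ((abs_add_le _ _).trans (add_le_add (hA j t ht) ?_)) ?_)
      · rw [abs_mul]
        calc _ ≤ B * 1 := mul_le_mul (hB j t ht) (hsc _) (abs_nonneg _) hB0
          _ = B := mul_one _
      · rw [abs_mul, abs_mul]
        calc _ ≤ C * N * 1 := mul_le_mul (mul_le_mul (hC j t ht) (hsum x) (abs_nonneg _) hC0) (hs2 _)
              (abs_nonneg _) (by positivity)
          _ = _ := mul_one _
    · refine LipschitzWith.of_dist_le_mul fun x y => ?_
      refine (dist_pi_le_iff (mul_nonneg (NNReal.coe_nonneg _) dist_nonneg)).2 fun j => ?_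
      rw [Real.dist_eq]
      have hd : ∀ i, |x i - y i| ≤ dist x y := fun i => by
        rw [← Real.dist_eq]; exact dist_le_pi_dist x y i
      have hS : |∑ i, sin (2 * x i) - ∑ i, sin (2 * y i)| ≤ N * (2 * dist x y) := by
        rw [← Finset.sum_sub_distrib]
        refine (Finset.abs_sum_le_sum_abs _ _).trans ?_
        refine (Finset.sum_le_sum fun i _ => (?_ : _ ≤ 2 * dist x y)).trans ?_
        · refine (hsl _ _).trans ?_
          rw [show 2 * x i - 2 * y i = 2 * (x i - y i) by ring, abs_mul, abs_of_pos (by norm_num : (0:ℝ) < 2)]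
          linarith [hd i]
        · simp
      have e : a j t + b j t * (sin (x j) * cos (x j)) + c j t * (∑ i, sin (2 * x i)) * sin (x j) ^ 2
          - (a j t + b j t * (sin (y j) * cos (y j)) + c j t * (∑ i, sin (2 * y i)) * sin (y j) ^ 2)
          = b j t * (sin (x j) * cos (x j) - sin (y j) * cos (y j))
            + c j t * ((∑ i, sin (2 * x i)) * (sin (x j) ^ 2 - sin (y j) ^ 2)
              + (∑ i, sin (2 * x i) - ∑ i, sin (2 * y i)) * sin (y j) ^ 2) := by ring
      rw [e]
      change _ ≤ (B + C * N * 4) * dist x y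
      have hd0 : 0 ≤ dist x y := dist_nonneg
      calc _ ≤ |b j t| * |sin (x j) * cos (x j) - sin (y j) * cos (y j)|
            + |c j t| * (|∑ i, sin (2 * x i)| * |sin (x j) ^ 2 - sin (y j) ^ 2|
              + |∑ i, sin (2 * x i) - ∑ i, sin (2 * y i)| * |sin (y j) ^ 2|) := by
            refine (abs_add_le _ _).trans (add_le_add (abs_mul _ _).le ?_)
            rw [abs_mul]
            refine mul_le_mul_of_nonneg_left ((abs_add_le _ _).trans (add_le_add (abs_mul _ _).le (abs_mul _ _).le))
              (abs_nonneg _)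
        _ ≤ B * dist x y + C * (N * (2 * dist x y) + N * (2 * dist x y) * 1) := by
            gcongr
            · exact hB j t ht
            · exact (hscl _ _).trans (hd j)
            · exact hC j t ht
            · exact hsum x
            · exact (hs2l _ _).trans (by linarith [hd j])
            · exact hs2 _
        _ = _ := by ring)
  refine ⟨fun j t => θ t j, fun j => congrFun h0 j, fun j t => ?_⟩
  exact (hasDerivAt_pi.1 (hθ t)) j

theorem stk_smooth {N : ℕ} (a b c : Fin N → ℝ → ℝ) (X : ℝ)
    (ha : ∀ i (n : ℕ), ContDiffOn ℝ n (a i) (Ioi X))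
    (hb : ∀ i (n : ℕ), ContDiffOn ℝ n (b i) (Ioi X)) (hc : ∀ i (n : ℕ), ContDiffOn ℝ n (c i) (Ioi X))
    (θ : Fin N → ℝ → ℝ)
    (hθ : ∀ j t, HasDerivAt (θ j)
      (a j t + b j t * (sin (θ j t) * cos (θ j t)) +
        c j t * (∑ i, sin (2 * θ i t)) * sin (θ j t) ^ 2) t) :
    ∀ (n : ℕ) j, ContDiffOn ℝ n (θ j) (Ioi X) := by
  intro n
  induction n with
  | zero =>
    intro j
    refine contDiffOn_zero.2 fun x _ => (hθ j x).continuousAt.continuousWithinAt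
  | succ n ih =>
    intro j
    push_cast
    rw [contDiffOn_succ_iff_deriv_of_isOpen isOpen_Ioi]
    refine ⟨fun x _ => (hθ j x).differentiableAt.differentiableWithinAt, by simp, ?_⟩
    have e : deriv (θ j) = fun t => (a j t + b j t * (sin (θ j t) * cos (θ j t)) +
        c j t * (∑ i, sin (2 * θ i t)) * sin (θ j t) ^ 2) := funext fun t => (hθ j t).deriv
    rw [e]
    have h1 := ih j
    refine ((ha j n).add ((hb j n).mul (h1.sin.mul h1.cos))).add
      (((hc j n).mul (ContDiffOn.sum fun i _ => ?_)).mul (h1.sin.pow 2))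
    exact (contDiffOn_const.mul (ih i)).sin

theorem stk_glue (f g f' g' : ℝ → ℝ) (c : ℝ) (hf : ∀ x ≤ c, HasDerivAt f (f' x) x)
    (hg : ∀ x ≥ c, HasDerivAt g (g' x) x) (h : f c = g c) (h' : f' c = g' c) (x : ℝ) :
    HasDerivAt (fun x => if x ≤ c then f x else g x) (if x ≤ c then f' x else g' x) x := by
  rcases lt_trichotomy x c with hx | hx | hx
  · rw [if_pos hx.le]
    refine (hf x hx.le).congr_of_eventuallyEq ?_
    filter_upwards [Iio_mem_nhds hx] with y hy
    rw [if_pos (le_of_lt hy)]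
  · subst hx
    rw [if_pos le_rfl]
    have h1 : HasDerivWithinAt (fun y => if y ≤ x then f y else g y) (f' x) (Iic x) x :=
      (hf x le_rfl).hasDerivWithinAt.congr (fun y hy => if_pos hy) (if_pos le_rfl)
    have h2 : HasDerivWithinAt (fun y => if y ≤ x then f y else g y) (f' x) (Ici x) x := by
      rw [h']
      refine (hg x le_rfl).hasDerivWithinAt.congr (fun y hy => ?_) ?_
      · split_ifs with hh
        · have : y = x := le_antisymm hh hy
          rw [this, h]
        · rfl
      · rw [if_pos le_rfl, h]
    have := h1.union h2
    rwa [Iic_union_Ici, hasDerivWithinAt_univ] at this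
  · rw [if_neg (not_le.2 hx)]
    refine (hg x hx.le).congr_of_eventuallyEq ?_
    filter_upwards [Ioi_mem_nhds hx] with y hy
    rw [if_neg (not_le.2 hy)]

theorem stk_polar (u v p : ℝ) (hp : 0 < p) (h : u ≠ 0 ∨ v ≠ 0) :
    ∃ l θ : ℝ, exp l * sin θ / sqrt p = u ∧ sqrt p * (exp l * cos θ) = v := by
  have hs : 0 < sqrt p := sqrt_pos.2 hp
  set z : ℂ := ⟨v / sqrt p, u * sqrt p⟩ with hz
  have hz0 : z ≠ 0 := by
    intro h0
    have h1 := congrArg Complex.re h0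
    have h2 := congrArg Complex.im h0
    simp only [hz, Complex.zero_re, Complex.zero_im] at h1 h2
    rcases h with h | h
    · exact (mul_ne_zero h hs.ne') h2
    · exact (div_ne_zero h hs.ne') h1
  refine ⟨log ‖z‖, Complex.arg z, ?_, ?_⟩
  · rw [exp_log (norm_pos_iff.2 hz0), Complex.norm_mul_sin_arg]
    simp only [hz]; field_simp
  · rw [exp_log (norm_pos_iff.2 hz0), Complex.norm_mul_cos_arg]
    simp only [hz]; field_simp

theorem stkP_deriv (α E x : ℝ) (h0 : 0 < x) (h : 0 < x ^ α + E) :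
    HasDerivAt (stkP α E) (stkP' α E x) x :=
  ((hasDerivAt_rpow_const (p := α) (Or.inl h0.ne')).add_const E).sqrt h.ne'

theorem stk_eig (α : ℝ) (hα0 : 0 < α) (vt : ℝ → ℝ) (hvt : Continuous vt)
    (hvt0 : ∀ x : ℝ, 0 ≤ x → vt x = -(x ^ α)) (E X1 : ℝ) (hX1 : 0 < X1)
    (hpos : ∀ x ≥ X1, 0 < x ^ α + E) (q : ℝ → ℝ) (hqc : Continuous q)
    (hq0 : ∀ x ≤ X1, q x = 0) (uL vL : ℝ → ℝ) (huL : ∀ x, HasDerivAt uL (vL x) x)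
    (hvL : ∀ x, HasDerivAt vL ((vt x - E) * uL x) x) (hne : ∀ x, uL x ≠ 0 ∨ vL x ≠ 0)
    (hint : ∀ b, IntegrableOn (fun x => uL x ^ 2) (Iic b)) (θ L : ℝ → ℝ)
    (hθ : ∀ x ≥ X1, HasDerivAt θ (stkP α E x + stkP' α E x / stkP α E x * (sin (θ x) * cos (θ x))
      - q x / stkP α E x * sin (θ x) ^ 2) x)
    (hL : ∀ x ≥ X1, HasDerivAt L (-(stkP' α E x / (2 * stkP α E x)) * cos (2 * θ x)
      + q x / (2 * stkP α E x) * sin (2 * θ x)) x)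
    (hu0 : exp (L X1) * sin (θ X1) / sqrt (stkP α E X1) = uL X1)
    (hv0 : sqrt (stkP α E X1) * (exp (L X1) * cos (θ X1)) = vL X1) (K : ℝ)
    (hdec : ∀ᶠ x in atTop, L x ≤ K + (-((2 - α) / 4) * log x - log (log x))) :
    HasL2Eigenfunction vt q E := by
  have hP : ∀ x ≥ X1, 0 < stkP α E x := fun x hx => sqrt_pos.2 (hpos x hx)
  have hpr := fun x (hx : x ≥ X1) => stk_prufer (stkP α E) (stkP' α E) θ L x (q x) (hP x hx)
    (stkP_deriv α E x (hX1.trans_le hx) (hpos x hx)) (hθ x hx) (hL x hx)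
  set uR : ℝ → ℝ := fun t => exp (L t) * sin (θ t) / sqrt (stkP α E t) with huR
  set vR : ℝ → ℝ := fun t => sqrt (stkP α E t) * (exp (L t) * cos (θ t)) with hvR
  have hW : ∀ x ≥ X1, (q x - stkP α E x ^ 2) = vt x + q x - E := fun x hx => by
    rw [hvt0 x (hX1.le.trans hx)]
    unfold stkP
    rw [sq_sqrt (hpos x hx).le]; ring
  set u : ℝ → ℝ := fun x => if x ≤ X1 then uL x else uR x with hu
  set v : ℝ → ℝ := fun x => if x ≤ X1 then vL x else vR x with hv
  have hud : ∀ x, HasDerivAt u (v x) x :=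
    stk_glue uL uR vL vR X1 (fun x _ => huL x) (fun x hx => (hpr x hx).1) hu0.symm hv0.symm
  have hvd : ∀ x, HasDerivAt v ((vt x + q x - E) * u x) x := by
    intro x
    have := stk_glue vL vR (fun x => (vt x + q x - E) * uL x) (fun x => (vt x + q x - E) * uR x) X1
      (fun x hx => by
        have := hvL x
        simp only [hq0 x hx, add_zero]; exact this) (fun x hx => by
        have := (hpr x hx).2
        rw [hW x hx] at this; exact this) hv0.symm
        (by simp only [huR]; rw [hu0]) x
    convert this using 1
    simp only [hu]; split_ifs <;> rfl
  have hdu : deriv u = v := funext fun x => (hud x).deriv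
  have hdv : deriv v = fun x => (vt x + q x - E) * u x := funext fun x => (hvd x).deriv
  have huc : Continuous u := continuous_iff_continuousAt.2 fun x => (hud x).continuousAt
  refine ⟨u, ?_, ?_, ?_, ?_⟩
  · rw [show (2 : WithTop ℕ∞) = 1 + 1 by norm_num, contDiff_succ_iff_deriv]
    refine ⟨fun x => (hud x).differentiableAt, by simp, ?_⟩
    rw [hdu, contDiff_one_iff_deriv]
    refine ⟨fun x => (hvd x).differentiableAt, ?_⟩
    rw [hdv]; fun_prop
  · intro x
    rw [hdu, hdv]; ring
  · by_contra hcon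
    push Not at hcon
    have h1 : u = fun _ => 0 := funext hcon
    have h2 : v X1 = 0 := by rw [← hdu, h1]; simp
    have h3 := hcon X1
    simp only [hu, hv, le_refl, if_true] at h2 h3
    rcases hne X1 with h | h
    · exact h h3
    · exact h h2
  · obtain ⟨M, hM0, hM⟩ := stkP_facts α E hα0
    have key : ∀ᶠ x in atTop, u x ^ 2 ≤ 2 * exp (2 * K) * (x⁻¹ / log x ^ 2) := by
      filter_upwards [hdec, hM, eventually_gt_atTop X1, eventually_gt_atTop 3] with x h1 h2 h3 h4
      have hx0 : 0 < x := by linarith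
      have hlog : 0 < log x := log_pos (by linarith)
      have hp : x ^ (α / 2) / 2 ≤ stkP α E x := h2.2.1
      have hxp : 0 < x ^ (α / 2) := rpow_pos_of_pos hx0 _
      simp only [hu, if_neg (not_le.2 h3), huR]
      rw [div_pow, sq_sqrt (hP x h3.le).le, mul_pow, div_le_iff₀ (hP x h3.le)]
      have e1 : exp (L x) ^ 2 ≤ exp (2 * K) * (x⁻¹ / log x ^ 2) * x ^ (α / 2) := by
        rw [← exp_nat_mul, rpow_def_of_pos hx0]
        have a1 : x⁻¹ = exp (- log x) := by rw [exp_neg, exp_log hx0]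
        have a2 : log x ^ 2 = exp (2 * log (log x)) := by
          rw [show 2 * log (log x) = ((2:ℕ):ℝ) * log (log x) by norm_num, exp_nat_mul, exp_log hlog]
        rw [a1, a2, ← exp_sub, ← exp_add, ← exp_add]
        refine exp_le_exp.2 ?_
        push_cast
        nlinarith
      have e2 : exp (L x) ^ 2 * sin (θ x) ^ 2 ≤ exp (L x) ^ 2 :=
        mul_le_of_le_one_right (sq_nonneg _) (sin_sq_le_one _)
      have hz : 0 ≤ exp (2 * K) * (x⁻¹ / log x ^ 2) := by positivity
      nlinarith
    obtain ⟨Y0, hY0⟩ := eventually_atTop.1 key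
    set Y := max (max Y0 X1) 3
    have i1 : IntegrableOn (fun x => u x ^ 2) (Iic X1) :=
      (hint X1).congr_fun (fun x hx => by simp only [hu]; rw [if_pos (show x ≤ X1 from hx)]) measurableSet_Iic
    have i2 : IntegrableOn (fun x => u x ^ 2) (Icc X1 Y) :=
      (huc.pow 2).continuousOn.integrableOn_Icc
    have i3 : IntegrableOn (fun x => u x ^ 2) (Ioi Y) := by
      have := (integrableOn_inv_div_log_sq_Ioi (c := Y)
        (by have : (3:ℝ) ≤ Y := le_max_right _ _
            linarith)).const_mul (2 * exp (2 * K))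
      refine Integrable.mono' this (huc.pow 2).aestronglyMeasurable ?_
      refine (ae_restrict_iff' measurableSet_Ioi).2 (Eventually.of_forall fun x hx => ?_)
      rw [Real.norm_eq_abs, abs_of_nonneg (sq_nonneg _)]
      exact hY0 x (((le_max_left _ _).trans (le_max_left _ _)).trans (le_of_lt hx))
    rw [← integrableOn_univ]
    refine ((i1.union i2).union i3).mono_set fun x _ => ?_
    rcases le_or_gt x X1 with h | h
    · exact Or.inl (Or.inl h)
    · rcases le_or_gt x Y with h' | h'
      · exact Or.inl (Or.inr ⟨h.le, h'⟩)
      · exact Or.inr h'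

theorem stk_limsup (α : ℝ) (hα2 : α < 2) (N : ℕ) (q : ℝ → ℝ) (θ : Fin N → ℝ → ℝ)
    (hq : ∀ᶠ x in atTop, q x = -((2 - α + 4 / log x) * x ^ (α / 2) / x) * ∑ i, sin (2 * θ i x)) :
    Filter.limsup (fun x : ℝ => x ^ (1 - α / 2) * |q x|) Filter.atTop
        ≤ (2 - α) * Real.exp (2 * Real.sqrt (Real.log N)) * N := by
  have hb : ∀ᶠ x in atTop, x ^ (1 - α / 2) * |q x| ≤ (2 - α + 4 / log x) * N := by
    filter_upwards [hq, eventually_gt_atTop 3] with x h1 h4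
    have hx0 : 0 < x := by linarith
    have hlog : 0 < log x := log_pos (by linarith)
    have hsum : |∑ i, sin (2 * θ i x)| ≤ N := by
      refine (Finset.abs_sum_le_sum_abs _ _).trans ?_
      refine (Finset.sum_le_sum fun i _ => abs_sin_le_one _).trans ?_
      simp
    have h0 : 0 < 2 - α + 4 / log x := by
      have : 0 < 4 / log x := by positivity
      linarith
    have hxp : 0 < x ^ (α / 2) := rpow_pos_of_pos hx0 _
    rw [h1, abs_mul, abs_neg, abs_of_pos (by positivity)]
    rw [rpow_sub hx0, rpow_one]
    calc _ = (2 - α + 4 / log x) * |∑ i, sin (2 * θ i x)| := by field_simp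
      _ ≤ _ := mul_le_mul_of_nonneg_left hsum h0.le
  have hN0 : (0:ℝ) ≤ N := Nat.cast_nonneg N
  have h2 : (2 - α) * N ≤ (2 - α) * Real.exp (2 * Real.sqrt (Real.log N)) * N := by
    have : 1 ≤ Real.exp (2 * Real.sqrt (Real.log N)) := one_le_exp (by positivity)
    have h3 : 0 < 2 - α := by linarith
    refine mul_le_mul_of_nonneg_right ?_ hN0
    nlinarith
  refine le_trans (le_of_forall_pos_le_add fun ε hε => ?_) h2
  have ht : Tendsto (fun x => (2 - α + 4 / log x) * N) atTop (nhds ((2 - α + 0) * N)) :=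
    ((tendsto_log_atTop.const_div_atTop 4).const_add _).mul_const _
  have h5 := ht.eventually_lt_const (u := (2 - α) * N + ε) (by linarith)
  refine Filter.limsup_le_of_le ?_ ?_
  · refine Filter.IsCoboundedUnder.of_frequently_ge (a := 0) (Eventually.frequently ?_)
    filter_upwards [eventually_gt_atTop 0] with x hx
    positivity
  · filter_upwards [hb, h5] with x h6 h7
    linarith

theorem stk_clamp (f : ℝ → ℝ) (X0 : ℝ) (h : ∀ x ≥ X0, ∀ n : ℕ, ContDiffAt ℝ n f x) :
    Continuous (fun x => f (max x X0)) ∧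
      ∀ n : ℕ, ContDiffOn ℝ n (fun x => f (max x X0)) (Ioi X0) := by
  constructor
  · refine continuous_iff_continuousAt.2 fun x => ?_
    have h1 : ContinuousAt f (max x X0) := (h _ (le_max_right _ _) 0).continuousAt
    have h2 : ContinuousAt (fun x => max x X0) x := by fun_prop
    exact ContinuousAt.comp (f := fun x => max x X0) h1 h2
  · intro n
    have h1 : ContDiffOn ℝ n f (Ioi X0) := fun x hx => (h x (le_of_lt hx) n).contDiffWithinAt
    exact h1.congr fun x hx => by rw [max_eq_left (le_of_lt hx)]

/-- For any `N ≥ 1` and any `N` distinct reals `E₁,…,E_N`, there is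
`q ∈ C^∞(ℝ)` with `limsup_{x→∞} x^{1-α/2}·|q(x)| ≤ (2-α)·e^{2√(ln N)}·N` such that for
each `j` there is an `L²(ℝ)` eigenfunction for energy `E_j` of `-D² + ṽ + q`. -/
theorem stark_line_N_eigenvalues
    (α : ℝ) (hα0 : 0 < α) (hα2 : α < 2)
    (vt : ℝ → ℝ) (hvt : Continuous vt)
    (hvt0 : ∀ x : ℝ, 0 ≤ x → vt x = -(x ^ α))
    (hvtop : Filter.Tendsto vt Filter.atBot Filter.atTop)
    (N : ℕ) (hN : 1 ≤ N) (E : Fin N → ℝ) (hE : Function.Injective E) :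
    ∃ q : ℝ → ℝ, ContDiff ℝ (⊤ : ℕ∞) q ∧
      Filter.limsup (fun x : ℝ => x ^ (1 - α / 2) * |q x|) Filter.atTop
        ≤ (2 - α) * Real.exp (2 * Real.sqrt (Real.log N)) * N ∧
      ∀ j : Fin N, HasL2Eigenfunction vt q (E j) := by
  have hev : ∀ᶠ x in atTop, ∀ j, 0 < x ^ α + E j := by
    refine eventually_all.2 fun j => ?_
    filter_upwards [(tendsto_rpow_atTop hα0).eventually_gt_atTop (- E j)] with x hx
    linarith
  obtain ⟨Z, hZ⟩ := eventually_atTop.1 hev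
  set X0 := max Z 3 with hX0def
  have hX03 : 3 ≤ X0 := le_max_right _ _
  have hpos : ∀ x ≥ X0, ∀ j, 0 < x ^ α + E j := fun x hx => hZ x ((le_max_left _ _).trans hx)
  set X1 := X0 + 1 with hX1def
  have hPpos : ∀ x ≥ X0, ∀ j, 0 < stkP α (E j) x := fun x hx j => sqrt_pos.2 (hpos x hx j)
  have hrp : ∀ β : ℝ, ∀ x ≥ X0, ∀ n : ℕ, ContDiffAt ℝ n (fun x : ℝ => x ^ β) x := fun β x hx n =>
    contDiffAt_rpow_const_of_ne (by linarith)
  have sA : ∀ j, ∀ x ≥ X0, ∀ n : ℕ, ContDiffAt ℝ n (stkP α (E j)) x := fun j x hx n =>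
    ((hrp α x hx n).add contDiffAt_const).sqrt (hpos x hx j).ne'
  have sB : ∀ j, ∀ x ≥ X0, ∀ n : ℕ,
      ContDiffAt ℝ n (fun x => stkP' α (E j) x / stkP α (E j) x) x := fun j x hx n => by
    refine ContDiffAt.div ?_ (sA j x hx n) (hPpos x hx j).ne'
    refine ContDiffAt.div (contDiffAt_const.mul (hrp (α - 1) x hx n)) (contDiffAt_const.mul (sA j x hx n)) ?_
    exact (mul_pos two_pos (hPpos x hx j)).ne'
  set g : ℝ → ℝ := fun x => (2 - α + 4 / log x) * x ^ (α / 2) / x with hg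
  have sg : ∀ x ≥ X0, ∀ n : ℕ, ContDiffAt ℝ n g x := fun x hx n => by
    have hx0 : x ≠ 0 := by linarith
    refine ContDiffAt.div (ContDiffAt.mul (contDiffAt_const.add (contDiffAt_const.div ?_ ?_))
      (hrp _ x hx n)) contDiffAt_id hx0
    · exact contDiffAt_log.2 hx0
    · exact (log_pos (by linarith)).ne'
  have sC : ∀ j, ∀ x ≥ X0, ∀ n : ℕ, ContDiffAt ℝ n (fun x => g x / stkP α (E j) x) x :=
    fun j x hx n => (sg x hx n).div (sA j x hx n) (hPpos x hx j).ne'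
  set χ : ℝ → ℝ := fun x => Real.smoothTransition (x - X1) with hχ
  have hχs : ∀ n : ℕ, ContDiff ℝ n χ := fun n =>
    (Real.smoothTransition.contDiff).comp (contDiff_id.sub contDiff_const)
  have hχc : Continuous χ := (hχs 0).continuous
  have hχ0 : ∀ x ≤ X1, χ x = 0 := fun x hx => Real.smoothTransition.zero_of_nonpos (by linarith)
  have hχ1 : ∀ x ≥ X1 + 1, χ x = 1 := fun x hx => Real.smoothTransition.one_of_one_le (by linarith)
  set a : Fin N → ℝ → ℝ := fun j x => stkP α (E j) (max x X0) with ha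
  set b : Fin N → ℝ → ℝ := fun j x => stkP' α (E j) (max x X0) / stkP α (E j) (max x X0) with hb
  set c : Fin N → ℝ → ℝ := fun j x => χ x * (g (max x X0) / stkP α (E j) (max x X0)) with hc
  have ca := fun j => stk_clamp _ X0 (sA j)
  have cb := fun j => stk_clamp _ X0 (sB j)
  have cc0 := fun j => stk_clamp _ X0 (sC j)
  have cac : ∀ j, Continuous (a j) := fun j => (ca j).1
  have cbc : ∀ j, Continuous (b j) := fun j => (cb j).1
  have ccc : ∀ j, Continuous (c j) := fun j => hχc.mul (cc0 j).1
  have ccs : ∀ j (n : ℕ), ContDiffOn ℝ n (c j) (Ioi X0) := fun j n =>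
    (hχs n).contDiffOn.mul ((cc0 j).2 n)
  have hleft := fun j => stk_left (fun x => vt x - E j) (hvt.sub continuous_const)
    (by simpa [sub_eq_add_neg] using tendsto_atTop_add_const_right _ (- E j) hvtop)
  choose uL vL huL hvL hne hint using hleft
  have hpol := fun j => stk_polar (uL j X1) (vL j X1) (stkP α (E j) X1)
    (hPpos X1 (by linarith) j) (hne j X1)
  choose l θ0 hl1 hl2 using hpol
  obtain ⟨θ, hθ0, hθ⟩ := stk_loop a b c cac cbc ccc X1 θ0
  have hθs := stk_smooth a b c X0 (fun j => (ca j).2) (fun j => (cb j).2) ccs θ hθ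
  have hθc : ∀ j, Continuous (θ j) := fun j =>
    continuous_iff_continuousAt.2 fun x => (hθ j x).continuousAt
  set q : ℝ → ℝ := fun x => -(χ x * g x) * ∑ i, sin (2 * θ i x) with hq
  have hq0 : ∀ x ≤ X1, q x = 0 := fun x hx => by simp [hq, hχ0 x hx]
  have hqs : ContDiff ℝ (⊤ : ℕ∞) q := by
    refine contDiff_infty.2 fun n => contDiff_iff_contDiffAt.2 fun x => ?_
    rcases lt_or_ge x X1 with hx | hx
    · refine (contDiffAt_const (c := (0:ℝ))).congr_of_eventuallyEq ?_
      filter_upwards [Iio_mem_nhds hx] with y hy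
      exact hq0 y (le_of_lt hy)
    · have hx' : X0 < x := by linarith
      refine ((hχs n).contDiffAt.mul (sg x hx'.le n)).neg.mul (ContDiffAt.sum fun i _ => ?_)
      exact (contDiffAt_const.mul ((hθs n i).contDiffAt (Ioi_mem_nhds hx'))).sin
  have hqe : ∀ᶠ x in atTop,
      q x = -((2 - α + 4 / log x) * x ^ (α / 2) / x) * ∑ i, sin (2 * θ i x) := by
    filter_upwards [eventually_ge_atTop (X1 + 1)] with x hx
    simp only [hq, hχ1 x hx, one_mul, hg]
  have hθR : ∀ j, ∀ x ≥ X1, HasDerivAt (θ j) (stkP α (E j) x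
      + stkP' α (E j) x / stkP α (E j) x * (sin (θ j x) * cos (θ j x))
      - q x / stkP α (E j) x * sin (θ j x) ^ 2) x := fun j x hx => by
    convert hθ j x using 1
    simp only [ha, hb, hc, hq, max_eq_left (show X0 ≤ x by linarith)]
    ring
  set F : Fin N → ℝ → ℝ := fun j x => -(b j x / 2) * cos (2 * θ j x)
    - (c j x * (∑ i, sin (2 * θ i x)) / 2) * sin (2 * θ j x) with hF
  have hFc : ∀ j, Continuous (F j) := fun j => by
    have := cbc j; have := ccc j
    simp only [hF]
    fun_prop
  set L : Fin N → ℝ → ℝ := fun j x => l j + ∫ t in X1..x, F j t with hL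
  have hLd : ∀ j x, HasDerivAt (L j) (F j x) x := fun j x =>
    (intervalIntegral.integral_hasDerivAt_right ((hFc j).intervalIntegrable _ _)
      ((hFc j).stronglyMeasurableAtFilter _ _) (hFc j).continuousAt).const_add _
  have hLR : ∀ j, ∀ x ≥ X1, HasDerivAt (L j)
      (-(stkP' α (E j) x / (2 * stkP α (E j) x)) * cos (2 * θ j x)
      + q x / (2 * stkP α (E j) x) * sin (2 * θ j x)) x := fun j x hx => by
    convert hLd j x using 1
    have := (hPpos x (by linarith) j).ne'
    simp only [hF, hb, hc, hq, max_eq_left (show X0 ≤ x by linarith)]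
    field_simp
    ring
  have hL1 : ∀ j, L j X1 = l j := fun j => by simp [hL]
  refine ⟨q, hqs, stk_limsup α hα2 N q θ hqe, fun j => ?_⟩
  obtain ⟨K, hK⟩ := stk_decay α hα0 hα2 E hE θ q hqe
    (fun j => (eventually_ge_atTop X1).mono fun x hx => hθR j x hx) j (L j)
    ((eventually_ge_atTop X1).mono fun x hx => hLR j x hx)
  exact stk_eig α hα0 vt hvt hvt0 (E j) X1 (by linarith) (fun x hx => hpos x (by linarith) j) q
    hqs.continuous hq0 (uL j) (vL j) (huL j) (hvL j) (hne j) (hint j) (θ j) (L j) (hθR j) (hLR j)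
    (by rw [hL1, hθ0]; exact hl1 j) (by rw [hL1, hθ0]; exact hl2 j) K hK
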